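/- Let n ≥ 2 and 0 < μ < n. Suppose u ∈ Cⁿ(ℝⁿ) satisfies condition (B) and the integral equation (IE). Then lim_{|x|→∞} |x|^μ v(x) = β, where β = ∫_{ℝⁿ} e^{((2n−μ)/2) u(y)} dy. -/

import Mathlib

open MeasureTheory Real Filter Metric

noncomputable section

/-- The nonlocal term `v(x) = ∫ e^{((2n-μ)/2) u(y)} / |x-y|^μ dy`. -/
noncomputable def V (n : ℕ) (μ : ℝ) (u : EuclideanSpace ℝ (Fin n) → ℝ)
    (x : EuclideanSpace ℝ (Fin n)) : ℝ :=
  ∫ y : EuclideanSpace ℝ (Fin n),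
    Real.exp ((2 * n - μ) / 2 * u y) / ‖x - y‖ ^ μ

/-- `βₙ = 2^{n-1} Γ(n/2+1) Γ(n/2) ωₙ` with `ωₙ` the volume of the unit ball in `ℝⁿ`. -/
noncomputable def betaN (n : ℕ) : ℝ :=
  2 ^ (n - 1) * Real.Gamma ((n : ℝ) / 2 + 1) * Real.Gamma ((n : ℝ) / 2) *
    (volume (Metric.ball (0 : EuclideanSpace ℝ (Fin n)) 1)).toReal

/-- Condition (B): finite weighted volume and finite total curvature. -/
def CondB (n : ℕ) (μ : ℝ) (u : EuclideanSpace ℝ (Fin n) → ℝ) : Prop :=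
  Integrable (fun y : EuclideanSpace ℝ (Fin n) => Real.exp ((2 * n - μ) / 2 * u y)) ∧
  Integrable (fun p : EuclideanSpace ℝ (Fin n) × EuclideanSpace ℝ (Fin n) =>
    Real.exp ((2 * n - μ) / 2 * u p.1) * Real.exp ((2 * n - μ) / 2 * u p.2) / ‖p.1 - p.2‖ ^ μ)

/-- The integral equation (IE). -/
def IE (n : ℕ) (μ : ℝ) (u : EuclideanSpace ℝ (Fin n) → ℝ) : Prop :=
  ∃ C : ℝ, ∀ x : EuclideanSpace ℝ (Fin n), u x = (1 / betaN n) *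
    (∫ y, Real.log ((‖y‖ + 1) / ‖x - y‖) * (V n μ u y * Real.exp ((2 * n - μ) / 2 * u y))) + C

/-- `α = (1/βₙ) ∫ v(y) e^{((2n-μ)/2) u(y)} dy`. -/
noncomputable def alphaC (n : ℕ) (μ : ℝ) (u : EuclideanSpace ℝ (Fin n) → ℝ) : ℝ :=
  (1 / betaN n) * ∫ y, V n μ u y * Real.exp ((2 * n - μ) / 2 * u y)

section HaarEstimates

variable {E : Type*} [NormedAddCommGroup E] [NormedSpace ℝ E] [FiniteDimensional ℝ E]
  [MeasurableSpace E] [BorelSpace E]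

theorem not_integrable_one_add_norm_rpow_neg [Nontrivial E] (ρ : Measure E) [ρ.IsAddHaarMeasure]
    {s : ℝ} (hs : s ≤ Module.finrank ℝ E) :
    ¬ Integrable (fun x : E => (1 + ‖x‖) ^ (-s)) ρ := by
  intro h
  have hd : 1 ≤ Module.finrank ℝ E := Module.finrank_pos
  have h1 := (integrable_fun_norm_addHaar ρ (f := fun t : ℝ => (1 + t) ^ (-s))).1 h
  have h2 : IntegrableOn (fun t : ℝ => t ^ (Module.finrank ℝ E - 1) • (1 + t) ^ (-s))
      (Set.Ioi 1) := h1.mono_set (Set.Ioi_subset_Ioi zero_le_one)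
  refine not_integrableOn_Ioi_inv (a := 1) ?_
  have h3 := h2.const_mul (2 ^ (Module.finrank ℝ E : ℝ))
  refine Integrable.mono' h3 (by fun_prop) ?_
  refine (ae_restrict_iff' measurableSet_Ioi).2 (.of_forall fun t ht => ?_)
  have ht : 1 < t := ht
  have ht0 : 0 < t := by linarith
  have e1 : (2 * t) ^ (-(Module.finrank ℝ E : ℝ)) ≤ (1 + t) ^ (-s) :=
    calc (2 * t) ^ (-(Module.finrank ℝ E : ℝ)) ≤ (1 + t) ^ (-(Module.finrank ℝ E : ℝ)) :=
          rpow_le_rpow_of_nonpos (by linarith) (by linarith) (by simp)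
      _ ≤ _ := rpow_le_rpow_of_exponent_le (by linarith) (by linarith)
  rw [Real.norm_of_nonneg (by positivity), smul_eq_mul]
  calc t⁻¹ = 2 ^ (Module.finrank ℝ E : ℝ) *
        (t ^ (Module.finrank ℝ E - 1) * (2 * t) ^ (-(Module.finrank ℝ E : ℝ))) := by
        rw [mul_rpow (by norm_num) ht0.le, rpow_neg (by norm_num), rpow_neg ht0.le,
          rpow_natCast, rpow_natCast]
        obtain ⟨k, hk⟩ := Nat.exists_eq_add_of_le' hd
        rw [hk, Nat.add_sub_cancel, pow_succ, pow_succ]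
        field_simp
    _ ≤ _ := by gcongr

theorem lintegral_ball_zero_norm_rpow_neg (ρ : Measure E) [ρ.IsAddHaarMeasure] (s : ℝ) {r : ℝ}
    (hr : 0 < r) :
    ∫⁻ y in ball (0 : E) r, ENNReal.ofReal (‖y‖ ^ (-s)) ∂ρ =
      ENNReal.ofReal (r ^ (Module.finrank ℝ E - s)) *
        ∫⁻ y in ball (0 : E) 1, ENNReal.ofReal (‖y‖ ^ (-s)) ∂ρ := by
  have hmap := ρ.map_addHaar_smul hr.ne'
  have hmeas : Measurable (fun y : E => (ball (0 : E) r).indicator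
      (fun y => ENNReal.ofReal (‖y‖ ^ (-s))) y) :=
    Measurable.indicator (by fun_prop) measurableSet_ball
  have h1 := lintegral_map (μ := ρ) hmeas (measurable_const_smul r)
  rw [hmap, lintegral_smul_measure, lintegral_indicator measurableSet_ball] at h1
  have h2 : ∀ y : E, (ball (0 : E) r).indicator (fun y => ENNReal.ofReal (‖y‖ ^ (-s))) (r • y) =
      ENNReal.ofReal (r ^ (-s)) *
        (ball (0 : E) 1).indicator (fun y => ENNReal.ofReal (‖y‖ ^ (-s))) y := by
    intro y
    have hmem : r • y ∈ ball (0 : E) r ↔ y ∈ ball (0 : E) 1 := by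
      simp only [mem_ball_zero_iff, norm_smul, Real.norm_of_nonneg hr.le]
      constructor <;> intro h <;> nlinarith
    by_cases hy : y ∈ ball (0 : E) 1
    · rw [Set.indicator_of_mem hy, Set.indicator_of_mem (hmem.2 hy), norm_smul,
        Real.norm_of_nonneg hr.le, mul_rpow hr.le (norm_nonneg _),
        ENNReal.ofReal_mul (by positivity)]
    · rw [Set.indicator_of_notMem hy, Set.indicator_of_notMem (fun h => hy (hmem.1 h)), mul_zero]
  simp_rw [h2] at h1
  rw [lintegral_const_mul' _ _ ENNReal.ofReal_ne_top, lintegral_indicator measurableSet_ball,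
    smul_eq_mul] at h1
  have h3 := congrArg (ENNReal.ofReal (r ^ (Module.finrank ℝ E : ℝ)) * ·) h1
  simp only [← mul_assoc] at h3
  rw [← ENNReal.ofReal_mul (by positivity), ← ENNReal.ofReal_mul (by positivity),
    ← rpow_add hr, rpow_natCast, abs_of_pos (by positivity), mul_inv_cancel₀ (by positivity),
    ENNReal.ofReal_one, one_mul] at h3
  rw [h3, sub_eq_add_neg]

theorem exists_lintegral_ball_norm_sub_rpow_neg_le [Nontrivial E] (ρ : Measure E)
    [ρ.IsAddHaarMeasure] {s : ℝ} (hs0 : 0 ≤ s) (hs : s < Module.finrank ℝ E) :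
    ∃ D : NNReal, ∀ (x w : E) (r : ℝ), 0 < r →
      ∫⁻ y in ball x r, ENNReal.ofReal (‖y - w‖ ^ (-s)) ∂ρ ≤
        D * ENNReal.ofReal (r ^ (Module.finrank ℝ E - s)) := by
  have hfin : ∫⁻ y in ball (0 : E) 1, ENNReal.ofReal (‖y‖ ^ (-s)) ∂ρ ≠ ⊤ := by
    have hi : IntegrableOn (fun y : E => ‖y‖ ^ (-s)) (ball 0 1) ρ :=
      integrableOn_ball_of_norm_le_rpow (C := 1) (α := s) Module.finrank_pos hs
        (.of_forall fun y => by rw [Real.norm_of_nonneg (by positivity), one_mul])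
        (Measurable.aestronglyMeasurable (by fun_prop))
    exact (hi.lintegral_lt_top).ne
  have hball : ρ (ball (0 : E) 1) ≠ ⊤ := measure_ball_lt_top.ne
  refine ⟨(∫⁻ y in ball (0 : E) 1, ENNReal.ofReal (‖y‖ ^ (-s)) ∂ρ).toNNReal +
    (ρ (ball (0 : E) 1)).toNNReal, fun x w r hr => ?_⟩
  rw [ENNReal.coe_add, ENNReal.coe_toNNReal hfin, ENNReal.coe_toNNReal hball, add_mul]
  have hcent : ∫⁻ y in ball w r, ENNReal.ofReal (‖y - w‖ ^ (-s)) ∂ρ =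
      ∫⁻ y in ball (0 : E) r, ENNReal.ofReal (‖y‖ ^ (-s)) ∂ρ := by
    rw [← lintegral_indicator measurableSet_ball, ← lintegral_indicator measurableSet_ball,
      ← lintegral_sub_right_eq_self
        (fun y : E => (ball 0 r).indicator (fun y => ENNReal.ofReal (‖y‖ ^ (-s))) y) w]
    refine lintegral_congr fun y => ?_
    have hmem : y - w ∈ ball (0 : E) r ↔ y ∈ ball w r := by
      rw [mem_ball_zero_iff, mem_ball_iff_norm]
    by_cases hy : y ∈ ball w r
    · rw [Set.indicator_of_mem hy, Set.indicator_of_mem (hmem.2 hy)]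
    · rw [Set.indicator_of_notMem hy, Set.indicator_of_notMem (fun h => hy (hmem.1 h))]
  calc ∫⁻ y in ball x r, ENNReal.ofReal (‖y - w‖ ^ (-s)) ∂ρ
      ≤ ∫⁻ y in ball w r ∪ (ball x r \ ball w r), ENNReal.ofReal (‖y - w‖ ^ (-s)) ∂ρ :=
        lintegral_mono_set (by rw [Set.union_sdiff_self]; exact Set.subset_union_right)
    _ ≤ (∫⁻ y in ball w r, ENNReal.ofReal (‖y - w‖ ^ (-s)) ∂ρ) +
        ∫⁻ y in ball x r \ ball w r, ENNReal.ofReal (‖y - w‖ ^ (-s)) ∂ρ :=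
        lintegral_union_le _ _ _
    _ ≤ _ := by
        gcongr
        · rw [hcent, lintegral_ball_zero_norm_rpow_neg ρ s hr, mul_comm]
        · calc ∫⁻ y in ball x r \ ball w r, ENNReal.ofReal (‖y - w‖ ^ (-s)) ∂ρ
              ≤ ∫⁻ _ in ball x r \ ball w r, ENNReal.ofReal (r ^ (-s)) ∂ρ := by
                refine setLIntegral_mono measurable_const fun y hy => ?_
                have hy2 : r ≤ ‖y - w‖ := by
                  simpa [mem_ball_iff_norm, dist_eq_norm] using hy.2
                exact ENNReal.ofReal_le_ofReal
                  (rpow_le_rpow_of_nonpos hr hy2 (by linarith))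
            _ ≤ ENNReal.ofReal (r ^ (-s)) * ρ (ball x r) := by
                rw [setLIntegral_const]
                gcongr
                exact Set.sdiff_subset
            _ = _ := by
                rw [ρ.addHaar_ball x hr.le, ← mul_assoc, ← ENNReal.ofReal_mul (by positivity),
                  ← rpow_natCast, ← rpow_add hr, mul_comm, neg_add_eq_sub]

end HaarEstimates

section ExponentialJensen

variable {Ω : Type*} [MeasurableSpace Ω]

theorem integrable_of_lintegral_exp_ne_top (ν : Measure Ω) [IsFiniteMeasure ν] {φ : Ω → ℝ}
    (hφ : Measurable φ) {B m : ℝ} (hB : ∀ z, -B ≤ φ z) (hm : 0 < m)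
    (hfin : ∫⁻ z, ENNReal.ofReal (exp (m * φ z)) ∂ν ≠ ⊤) :
    Integrable (fun z => exp (m * φ z)) ν ∧ Integrable φ ν := by
  have hexp : Integrable (fun z => exp (m * φ z)) ν := by
    refine ⟨Measurable.aestronglyMeasurable (by fun_prop), ?_⟩
    rw [hasFiniteIntegral_iff_ofReal (.of_forall fun z => (exp_pos _).le)]
    exact hfin.lt_top
  refine ⟨hexp, Integrable.mono' ((integrable_const |B|).add (hexp.const_mul m⁻¹))
    hφ.aestronglyMeasurable (.of_forall fun z => ?_)⟩
  have h1 : φ z ≤ m⁻¹ * exp (m * φ z) := by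
    rw [inv_mul_eq_div, le_div_iff₀ hm]
    linarith [add_one_le_exp (m * φ z)]
  have h2 := hB z
  have h3 := le_abs_self B
  have h4 : 0 < m⁻¹ * exp (m * φ z) := by positivity
  rw [Real.norm_eq_abs, abs_le]
  simp only [Pi.add_apply]
  constructor <;> linarith [abs_nonneg B]

theorem exp_integral_le_inv_mul_integral_exp (ν : Measure Ω) [IsFiniteMeasure ν] {φ : Ω → ℝ}
    (hm : 0 < ν.real Set.univ) (hφ : Integrable φ ν)
    (hexp : Integrable (fun z => exp (ν.real Set.univ * φ z)) ν) :
    exp (∫ z, φ z ∂ν) ≤ (ν.real Set.univ)⁻¹ * ∫ z, exp (ν.real Set.univ * φ z) ∂ν := by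
  set m := ν.real Set.univ with hmdef
  set A := ∫ z, φ z ∂ν with hA
  have hpt : ∀ z, exp A * ((1 - A) + m * φ z) ≤ exp (m * φ z) := by
    intro z
    calc exp A * ((1 - A) + m * φ z) ≤ exp A * exp (m * φ z - A) := by
          gcongr
          linarith [add_one_le_exp (m * φ z - A)]
      _ = exp (m * φ z) := by rw [← exp_add]; ring_nf
  have hint : ∫ z, exp A * ((1 - A) + m * φ z) ∂ν ≤ ∫ z, exp (m * φ z) ∂ν :=
    integral_mono (((integrable_const _).add (hφ.const_mul m)).const_mul _) hexp hpt
  rw [integral_const_mul, integral_add (integrable_const _) (hφ.const_mul m), integral_const,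
    integral_const_mul, ← hA, ← hmdef, smul_eq_mul] at hint
  rw [inv_mul_eq_div, le_div_iff₀ hm]
  linarith

theorem ofReal_exp_integral_le (ν : Measure Ω) [IsFiniteMeasure ν] {φ : Ω → ℝ}
    (hφ : Measurable φ) {B : ℝ} (hB : ∀ z, -B ≤ φ z) {S : Set Ω} (hS : MeasurableSet S) {b : ℝ}
    (hb : ∀ z ∈ S, φ z ≤ -b) :
    ENNReal.ofReal (exp (∫ z, φ z ∂ν)) ≤ ENNReal.ofReal (exp (-b * ν.real S)) *
      (1 + ENNReal.ofReal (ν.real Sᶜ)⁻¹ *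
        ∫⁻ z in Sᶜ, ENNReal.ofReal (exp (ν.real Sᶜ * φ z)) ∂ν) := by
  have hSint : IntegrableOn φ S ν := by
    refine Integrable.mono' (integrable_const (max B (-b))) hφ.aestronglyMeasurable ?_
    refine (ae_restrict_iff' hS).2 (.of_forall fun z hz => ?_)
    rw [Real.norm_eq_abs, abs_le]
    have := hB z
    have := hb z hz
    constructor <;> linarith [le_max_left B (-b), le_max_right B (-b)]
  have hSle : ∫ z in S, φ z ∂ν ≤ -b * ν.real S := by
    calc ∫ z in S, φ z ∂ν ≤ ∫ _ in S, -b ∂ν :=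
          setIntegral_mono_on hSint (integrable_const _) hS hb
      _ = -b * ν.real S := by rw [setIntegral_const, smul_eq_mul, mul_comm]
  have hsplit : IntegrableOn φ Sᶜ ν →
      exp (∫ z, φ z ∂ν) ≤ exp (-b * ν.real S) * exp (∫ z in Sᶜ, φ z ∂ν) := by
    intro h
    have hall : Integrable φ ν := by
      rw [← integrableOn_univ, ← Set.union_compl_self S]
      exact hSint.union h
    rw [← integral_add_compl hS hall, exp_add]
    gcongr
  rcases (measureReal_nonneg (μ := ν) (s := Sᶜ)).eq_or_lt with hm | hm
  · have h0 : ν Sᶜ = 0 := (measureReal_eq_zero_iff).1 hm.symm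
    have h1 : ν.restrict Sᶜ = 0 := Measure.restrict_eq_zero.2 h0
    have h2 := hsplit (by rw [IntegrableOn, h1]; exact integrable_zero_measure)
    rw [h1, integral_zero_measure, exp_zero, mul_one] at h2
    refine (ENNReal.ofReal_le_ofReal h2).trans (le_mul_of_one_le_right' le_self_add)
  · by_cases hfin : ∫⁻ z in Sᶜ, ENNReal.ofReal (exp (ν.real Sᶜ * φ z)) ∂ν = ⊤
    · rw [hfin, ENNReal.mul_top (by simpa using hm), add_top,
        ENNReal.mul_top (by simpa using exp_pos _)]
      exact le_top
    · have hu : (ν.restrict Sᶜ).real Set.univ = ν.real Sᶜ := by simp [Measure.real]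
      obtain ⟨hexp, hint⟩ := integrable_of_lintegral_exp_ne_top (ν.restrict Sᶜ) hφ hB hm hfin
      have h1 := exp_integral_le_inv_mul_integral_exp (ν.restrict Sᶜ) (by rwa [hu]) hint
        (by rwa [hu])
      rw [hu] at h1
      calc ENNReal.ofReal (exp (∫ z, φ z ∂ν))
          ≤ ENNReal.ofReal (exp (-b * ν.real S) *
            ((ν.real Sᶜ)⁻¹ * ∫ z in Sᶜ, exp (ν.real Sᶜ * φ z) ∂ν)) := by
            refine ENNReal.ofReal_le_ofReal ((hsplit hint).trans ?_)
            gcongr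
        _ = ENNReal.ofReal (exp (-b * ν.real S)) * (ENNReal.ofReal (ν.real Sᶜ)⁻¹ *
            ∫⁻ z in Sᶜ, ENNReal.ofReal (exp (ν.real Sᶜ * φ z)) ∂ν) := by
            rw [ENNReal.ofReal_mul (exp_pos _).le, ENNReal.ofReal_mul (by positivity),
              ofReal_integral_eq_lintegral_ofReal hexp (.of_forall fun z => (exp_pos _).le)]
        _ ≤ _ := by
            gcongr
            exact le_add_self

end ExponentialJensen

section LogKernel

variable {E : Type*} [NormedAddCommGroup E]

theorem neg_log_one_add_norm_le_log_div (y z : E) :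
    -log (1 + ‖y‖) ≤ log ((‖z‖ + 1) / ‖y - z‖) := by
  have hy : 0 ≤ log (1 + ‖y‖) := log_nonneg (by linarith [norm_nonneg y])
  rcases (norm_nonneg (y - z)).eq_or_lt with h | h
  · simpa [← h] using hy
  · rw [← log_inv]
    refine log_le_log (by positivity) ?_
    rw [inv_eq_one_div, div_le_div_iff₀ (by positivity) h, one_mul]
    nlinarith [norm_sub_le y z, norm_nonneg y, norm_nonneg z]

theorem exp_mul_log_div_le {p t : ℝ} (hp0 : 0 ≤ p) (hp1 : p ≤ 1) {y : E} (z : E)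
    (ht : ‖y‖ + 1 ≤ t) :
    exp (p * log ((‖z‖ + 1) / ‖y - z‖)) ≤ 1 + t ^ p * ‖y - z‖ ^ (-p) := by
  have ht0 : 0 ≤ t := by linarith [norm_nonneg y]
  rcases (norm_nonneg (y - z)).eq_or_lt with h | h
  · have : 0 ≤ t ^ p * (0 : ℝ) ^ (-p) := by positivity
    simpa [← h] using this
  · have hz : ‖z‖ ≤ ‖y‖ + ‖y - z‖ := by
      have := norm_sub_le y (y - z)
      simpa using this
    rw [mul_comm, ← rpow_def_of_pos (by positivity)]
    calc ((‖z‖ + 1) / ‖y - z‖) ^ p ≤ (1 + t / ‖y - z‖) ^ p := by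
          refine rpow_le_rpow (by positivity) ?_ hp0
          rw [one_add_div h.ne']
          exact div_le_div_of_nonneg_right (by linarith) h.le
      _ ≤ 1 ^ p + (t / ‖y - z‖) ^ p :=
          rpow_add_le_add_rpow zero_le_one (by positivity) hp0 hp1
      _ = _ := by rw [one_rpow, div_rpow ht0 h.le, rpow_neg h.le, div_eq_mul_inv]

theorem log_div_le_neg_log_sub_log {R : ℝ} (hR : 0 ≤ R) {y z : E} (hz : ‖z‖ ≤ R)
    (hy : 2 * R < ‖y‖) :
    log ((‖z‖ + 1) / ‖y - z‖) ≤ -(log (‖y‖ / (2 * (R + 1)))) := by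
  have hyz : ‖y‖ / 2 ≤ ‖y - z‖ := by linarith [norm_sub_norm_le y z]
  have hy0 : 0 < ‖y‖ := by linarith
  rw [← log_inv, inv_div]
  refine log_le_log (div_pos (by positivity) (by linarith)) ?_
  rw [div_le_div_iff₀ (by linarith) hy0]
  nlinarith [norm_nonneg z]

theorem rpow_neg_mul_rpow_neg_le {a b s p : ℝ} (ha : 0 ≤ a) (hb : 0 ≤ b) (hs : 0 < s)
    (hp : 0 ≤ p) :
    a ^ (-s) * b ^ (-p) ≤ a ^ (-(s + p)) + b ^ (-(s + p)) := by
  rcases ha.eq_or_lt with rfl | ha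
  · rw [zero_rpow (by linarith), zero_mul]
    positivity
  rcases hb.eq_or_lt with rfl | hb
  · rcases hp.eq_or_lt with rfl | hp
    · simp only [neg_zero, rpow_zero, mul_one, add_zero]
      exact le_add_of_nonneg_right (by positivity)
    · rw [zero_rpow (neg_ne_zero.2 hp.ne'), mul_zero]
      positivity
  rw [neg_add, rpow_add ha, rpow_add hb]
  rcases le_total a b with hab | hab
  · have : b ^ (-p) ≤ a ^ (-p) := rpow_le_rpow_of_nonpos ha hab (by linarith)
    have : a ^ (-s) * b ^ (-p) ≤ a ^ (-s) * a ^ (-p) := by gcongr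
    have : 0 ≤ b ^ (-s) * b ^ (-p) := by positivity
    linarith
  · have : a ^ (-s) ≤ b ^ (-s) := rpow_le_rpow_of_nonpos hb hab (by linarith)
    have : a ^ (-s) * b ^ (-p) ≤ b ^ (-s) * b ^ (-p) := by gcongr
    have : 0 ≤ a ^ (-s) * a ^ (-p) := by positivity
    linarith

end LogKernel

theorem exists_measure_closedBall_gt_and_compl_lt {E : Type*} [NormedAddCommGroup E]
    [MeasurableSpace E] [BorelSpace E] (ν : Measure E) [IsFiniteMeasure ν]
    {d ε : ℝ} (hd : d < ν.real Set.univ) (hε : 0 < ε) :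
    ∃ R : ℝ, 0 ≤ R ∧ d < ν.real (closedBall 0 R) ∧ ν.real (closedBall 0 R)ᶜ < ε := by
  have hlim : Tendsto (fun k : ℕ => ν.real (closedBall (0 : E) k)) atTop
      (nhds (ν.real Set.univ)) := by
    have h := tendsto_measure_iUnion_atTop (μ := ν) (s := fun k : ℕ => closedBall (0 : E) k)
      (fun i j hij => closedBall_subset_closedBall (by exact_mod_cast hij))
    rw [iUnion_closedBall_nat] at h
    exact (ENNReal.tendsto_toReal (measure_ne_top ν _)).comp h
  obtain ⟨k, hk1, hk2⟩ := ((hlim.eventually (lt_mem_nhds hd)).and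
    (hlim.eventually (lt_mem_nhds (sub_lt_self (ν.real Set.univ) hε)))).exists
  refine ⟨k, Nat.cast_nonneg k, hk1, ?_⟩
  rw [measureReal_compl isClosed_closedBall.measurableSet]
  linarith

section NearField

variable {E : Type*} [NormedAddCommGroup E] [NormedSpace ℝ E] [FiniteDimensional ℝ E]
  [MeasurableSpace E] [BorelSpace E] [Nontrivial E]

theorem exists_lintegral_ball_rpow_neg_mul_exp_log_le (ρ : Measure E) [ρ.IsAddHaarMeasure]
    {s p : ℝ} (hs : 0 < s) (hp0 : 0 ≤ p) (hp1 : p ≤ 1) (hsp : s + p < Module.finrank ℝ E) :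
    ∃ D : NNReal, ∀ (x z : E) (r : ℝ), 1 ≤ r → ‖x‖ = 2 * r →
      ∫⁻ y in ball x r, ENNReal.ofReal (‖x - y‖ ^ (-s)) *
          ENNReal.ofReal (exp (p * log ((‖z‖ + 1) / ‖y - z‖))) ∂ρ ≤
        D * ENNReal.ofReal (r ^ (Module.finrank ℝ E - s)) := by
  obtain ⟨D₁, hD₁⟩ := exists_lintegral_ball_norm_sub_rpow_neg_le ρ hs.le
    (by linarith : s < Module.finrank ℝ E)
  obtain ⟨D₂, hD₂⟩ := exists_lintegral_ball_norm_sub_rpow_neg_le ρ (by linarith : 0 ≤ s + p) hsp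
  refine ⟨D₁ + (4 ^ p : ℝ).toNNReal * (D₂ + D₂), fun x z r hr hx => ?_⟩
  have hr0 : 0 < r := by linarith
  have hpt : ∀ y ∈ ball x r, ENNReal.ofReal (‖x - y‖ ^ (-s)) *
      ENNReal.ofReal (exp (p * log ((‖z‖ + 1) / ‖y - z‖))) ≤
      ENNReal.ofReal (‖y - x‖ ^ (-s)) + ENNReal.ofReal ((4 * r) ^ p) *
        (ENNReal.ofReal (‖y - x‖ ^ (-(s + p))) + ENNReal.ofReal (‖y - z‖ ^ (-(s + p)))) := by
    intro y hy
    have hyx : ‖y - x‖ < r := by rwa [mem_ball_iff_norm] at hy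
    have hyn : ‖y‖ + 1 ≤ 4 * r := by linarith [norm_sub_norm_le y x]
    rw [norm_sub_rev x y, ← ENNReal.ofReal_mul (by positivity),
      ← ENNReal.ofReal_add (by positivity) (by positivity), ← ENNReal.ofReal_mul (by positivity),
      ← ENNReal.ofReal_add (by positivity) (by positivity)]
    refine ENNReal.ofReal_le_ofReal ?_
    calc ‖y - x‖ ^ (-s) * exp (p * log ((‖z‖ + 1) / ‖y - z‖))
        ≤ ‖y - x‖ ^ (-s) * (1 + (4 * r) ^ p * ‖y - z‖ ^ (-p)) := by
          gcongr
          exact exp_mul_log_div_le hp0 hp1 z hyn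
      _ = ‖y - x‖ ^ (-s) + (4 * r) ^ p * (‖y - x‖ ^ (-s) * ‖y - z‖ ^ (-p)) := by ring
      _ ≤ _ := by
          gcongr
          exact rpow_neg_mul_rpow_neg_le (norm_nonneg _) (norm_nonneg _) hs hp0
  have hpow : ENNReal.ofReal ((4 * r) ^ p) * ENNReal.ofReal (r ^ (Module.finrank ℝ E - (s + p))) =
      ENNReal.ofReal (4 ^ p) * ENNReal.ofReal (r ^ (Module.finrank ℝ E - s)) := by
    rw [← ENNReal.ofReal_mul (by positivity), ← ENNReal.ofReal_mul (by positivity),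
      mul_rpow (by norm_num) hr0.le, mul_assoc, ← rpow_add hr0]
    congr 3
    ring
  calc _ ≤ ∫⁻ y in ball x r, (ENNReal.ofReal (‖y - x‖ ^ (-s)) + ENNReal.ofReal ((4 * r) ^ p) *
        (ENNReal.ofReal (‖y - x‖ ^ (-(s + p))) + ENNReal.ofReal (‖y - z‖ ^ (-(s + p))))) ∂ρ :=
        setLIntegral_mono (by fun_prop) hpt
    _ = (∫⁻ y in ball x r, ENNReal.ofReal (‖y - x‖ ^ (-s)) ∂ρ) + ENNReal.ofReal ((4 * r) ^ p) *
        ((∫⁻ y in ball x r, ENNReal.ofReal (‖y - x‖ ^ (-(s + p))) ∂ρ) +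
          ∫⁻ y in ball x r, ENNReal.ofReal (‖y - z‖ ^ (-(s + p))) ∂ρ) := by
        rw [lintegral_add_left (by fun_prop), lintegral_const_mul _ (by fun_prop),
          lintegral_add_left (by fun_prop)]
    _ ≤ D₁ * ENNReal.ofReal (r ^ (Module.finrank ℝ E - s)) + ENNReal.ofReal ((4 * r) ^ p) *
        (D₂ * ENNReal.ofReal (r ^ (Module.finrank ℝ E - (s + p))) +
          D₂ * ENNReal.ofReal (r ^ (Module.finrank ℝ E - (s + p)))) := by
        gcongr
        · exact hD₁ x x r hr0
        · exact hD₂ x x r hr0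
        · exact hD₂ x z r hr0
    _ = D₁ * ENNReal.ofReal (r ^ (Module.finrank ℝ E - s)) +
        (ENNReal.ofReal ((4 * r) ^ p) * ENNReal.ofReal (r ^ (Module.finrank ℝ E - (s + p)))) *
          (D₂ + D₂) := by ring
    _ = _ := by
        rw [hpow, ENNReal.coe_add, ENNReal.coe_mul, ENNReal.coe_add]
        simp only [ENNReal.ofReal]
        ring

theorem tendsto_rpow_mul_lintegral_ball_exp_logPotential (ρ : Measure E) [ρ.IsAddHaarMeasure]
    (ν : Measure E) [IsFiniteMeasure ν] {s : ℝ} (hs : 0 < s) (hsd : s < Module.finrank ℝ E)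
    (hν : Module.finrank ℝ E < ν.real Set.univ) :
    Tendsto (fun x : E => ENNReal.ofReal (‖x‖ ^ s) *
      ∫⁻ y in ball x (‖x‖ / 2), ENNReal.ofReal (‖x - y‖ ^ (-s)) *
        ENNReal.ofReal (exp (∫ z, log ((‖z‖ + 1) / ‖y - z‖) ∂ν)) ∂ρ)
      (comap (fun x : E => ‖x‖) atTop) (nhds 0) := by
  obtain ⟨R, hR0, hR1, hR2⟩ := exists_measure_closedBall_gt_and_compl_lt ν hν
    (lt_min one_pos (sub_pos.2 hsd))
  set S : Set E := closedBall 0 R with hSdef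
  have hS : MeasurableSet S := isClosed_closedBall.measurableSet
  set m : ℝ := ν.real Sᶜ with hm
  set M : ℝ := ν.real S with hM
  have hm0 : 0 ≤ m := measureReal_nonneg
  have hm1 : m ≤ 1 := (hR2.trans_le (min_le_left _ _)).le
  have hm2 : s + m < Module.finrank ℝ E := by linarith [hR2.trans_le (min_le_right _ _)]
  have hM0 : 0 < M := lt_of_le_of_lt (by positivity) hR1
  obtain ⟨D₀, hD₀⟩ := exists_lintegral_ball_norm_sub_rpow_neg_le ρ hs.le hsd
  obtain ⟨D, hD⟩ := exists_lintegral_ball_rpow_neg_mul_exp_log_le ρ hs hm0 hm1 hm2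
  set K : ENNReal := D₀ + ENNReal.ofReal m⁻¹ * (D * ν Sᶜ) with hK
  have hKtop : K ≠ ⊤ := by
    have := measure_ne_top ν Sᶜ
    finiteness
  set A : ENNReal := ENNReal.ofReal (2 ^ s * (2 * (R + 1)) ^ M) * K with hA
  have hAtop : A ≠ ⊤ := ENNReal.mul_ne_top ENNReal.ofReal_ne_top hKtop
  have hbound : ∀ᶠ x : E in comap (fun x : E => ‖x‖) atTop,
      ENNReal.ofReal (‖x‖ ^ s) * ∫⁻ y in ball x (‖x‖ / 2), ENNReal.ofReal (‖x - y‖ ^ (-s)) *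
        ENNReal.ofReal (exp (∫ z, log ((‖z‖ + 1) / ‖y - z‖) ∂ν)) ∂ρ ≤
      A * ENNReal.ofReal ((‖x‖ / 2) ^ (-(M - Module.finrank ℝ E))) := by
    filter_upwards [preimage_mem_comap (eventually_ge_atTop (max 2 (4 * R + 1)))] with x hx
    have hx : max 2 (4 * R + 1) ≤ ‖x‖ := hx
    have hx2 := (le_max_left _ _).trans hx
    have hx4 := (le_max_right _ _).trans hx
    obtain ⟨r, hr⟩ : ∃ r, r = ‖x‖ / 2 := ⟨_, rfl⟩
    have hxr : ‖x‖ = 2 * r := by linarith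
    have hr1 : 1 ≤ r := by linarith
    have hr0 : 0 < r := by linarith
    rw [← hr]
    have hpt : ∀ y ∈ ball x r, ENNReal.ofReal (‖x - y‖ ^ (-s)) *
        ENNReal.ofReal (exp (∫ z, log ((‖z‖ + 1) / ‖y - z‖) ∂ν)) ≤
        ENNReal.ofReal ((r / (2 * (R + 1))) ^ (-M)) * (ENNReal.ofReal (‖y - x‖ ^ (-s)) +
          ENNReal.ofReal m⁻¹ * ∫⁻ z in Sᶜ, ENNReal.ofReal (‖x - y‖ ^ (-s)) *
            ENNReal.ofReal (exp (m * log ((‖z‖ + 1) / ‖y - z‖))) ∂ν) := by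
      intro y hy
      have hxy : ‖x - y‖ < r := by rwa [mem_ball_iff_norm'] at hy
      have hyr : r < ‖y‖ := by linarith [norm_sub_norm_le x y]
      have h1 := ofReal_exp_integral_le ν (φ := fun z => log ((‖z‖ + 1) / ‖y - z‖)) (by fun_prop)
        (neg_log_one_add_norm_le_log_div y) hS (b := log (‖y‖ / (2 * (R + 1))))
        (fun z hz => log_div_le_neg_log_sub_log hR0 (by simpa [hSdef] using hz) (by linarith))
      have h2 : exp (-log (‖y‖ / (2 * (R + 1))) * M) ≤ (r / (2 * (R + 1))) ^ (-M) := by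
        rw [neg_mul_comm, ← rpow_def_of_pos (div_pos (by linarith) (by linarith))]
        refine rpow_le_rpow_of_nonpos (by positivity) ?_ (by linarith)
        gcongr
      rw [lintegral_const_mul' _ _ ENNReal.ofReal_ne_top, norm_sub_rev y x]
      calc _ ≤ ENNReal.ofReal (‖x - y‖ ^ (-s)) * (ENNReal.ofReal ((r / (2 * (R + 1))) ^ (-M)) *
            (1 + ENNReal.ofReal m⁻¹ *
              ∫⁻ z in Sᶜ, ENNReal.ofReal (exp (m * log ((‖z‖ + 1) / ‖y - z‖))) ∂ν)) := by
            gcongr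
            refine h1.trans ?_
            gcongr
        _ = _ := by ring
    have hmeas : Measurable (fun q : E × E => ENNReal.ofReal (‖x - q.1‖ ^ (-s)) *
        ENNReal.ofReal (exp (m * log ((‖q.2‖ + 1) / ‖q.1 - q.2‖)))) := by fun_prop
    have hmeas' : Measurable (fun y : E => ∫⁻ z in Sᶜ, ENNReal.ofReal (‖x - y‖ ^ (-s)) *
        ENNReal.ofReal (exp (m * log ((‖z‖ + 1) / ‖y - z‖))) ∂ν) :=
      hmeas.lintegral_prod_right'
    have hswap : ∫⁻ y in ball x r, (∫⁻ z in Sᶜ, ENNReal.ofReal (‖x - y‖ ^ (-s)) *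
        ENNReal.ofReal (exp (m * log ((‖z‖ + 1) / ‖y - z‖))) ∂ν) ∂ρ ≤
        D * ENNReal.ofReal (r ^ (Module.finrank ℝ E - s)) * ν Sᶜ := by
      rw [lintegral_lintegral_swap hmeas.aemeasurable, ← setLIntegral_const]
      exact lintegral_mono fun z => hD x z r hr1 hxr
    calc _ ≤ ENNReal.ofReal (‖x‖ ^ s) * ∫⁻ y in ball x r,
          ENNReal.ofReal ((r / (2 * (R + 1))) ^ (-M)) * (ENNReal.ofReal (‖y - x‖ ^ (-s)) +
          ENNReal.ofReal m⁻¹ * ∫⁻ z in Sᶜ, ENNReal.ofReal (‖x - y‖ ^ (-s)) *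
            ENNReal.ofReal (exp (m * log ((‖z‖ + 1) / ‖y - z‖))) ∂ν) ∂ρ := by
          gcongr 1
          exact setLIntegral_mono (by fun_prop) hpt
      _ = ENNReal.ofReal (‖x‖ ^ s) * (ENNReal.ofReal ((r / (2 * (R + 1))) ^ (-M)) *
          ((∫⁻ y in ball x r, ENNReal.ofReal (‖y - x‖ ^ (-s)) ∂ρ) + ENNReal.ofReal m⁻¹ *
          ∫⁻ y in ball x r, (∫⁻ z in Sᶜ, ENNReal.ofReal (‖x - y‖ ^ (-s)) *
            ENNReal.ofReal (exp (m * log ((‖z‖ + 1) / ‖y - z‖))) ∂ν) ∂ρ)) := by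
          rw [lintegral_const_mul _ (by fun_prop), lintegral_add_left (by fun_prop),
            lintegral_const_mul _ hmeas']
      _ ≤ ENNReal.ofReal (‖x‖ ^ s) * (ENNReal.ofReal ((r / (2 * (R + 1))) ^ (-M)) *
          (D₀ * ENNReal.ofReal (r ^ (Module.finrank ℝ E - s)) + ENNReal.ofReal m⁻¹ *
            (D * ENNReal.ofReal (r ^ (Module.finrank ℝ E - s)) * ν Sᶜ))) := by
          gcongr
          exact hD₀ x x r hr0
      _ = (ENNReal.ofReal (‖x‖ ^ s) * ENNReal.ofReal ((r / (2 * (R + 1))) ^ (-M)) *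
          ENNReal.ofReal (r ^ (Module.finrank ℝ E - s))) * K := by
          rw [hK]
          ring
      _ = _ := by
          rw [hA, mul_right_comm (ENNReal.ofReal (2 ^ s * (2 * (R + 1)) ^ M)) K,
            ← ENNReal.ofReal_mul (by positivity), ← ENNReal.ofReal_mul (by positivity),
            ← ENNReal.ofReal_mul (by positivity)]
          congr 2
          rw [hxr, mul_rpow (by norm_num) hr0.le, div_rpow hr0.le (by positivity),
            rpow_neg (by positivity : 0 ≤ 2 * (R + 1)), div_inv_eq_mul]
          calc 2 ^ s * r ^ s * (r ^ (-M) * (2 * (R + 1)) ^ M) * r ^ (Module.finrank ℝ E - s)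
              = 2 ^ s * (2 * (R + 1)) ^ M *
                (r ^ s * r ^ (-M) * r ^ (Module.finrank ℝ E - s)) := by ring
            _ = _ := by
              rw [← rpow_add hr0, ← rpow_add hr0]
              congr 2
              ring
  have hzero : Tendsto (fun x : E => A *
      ENNReal.ofReal ((‖x‖ / 2) ^ (-(M - Module.finrank ℝ E))))
      (comap (fun x : E => ‖x‖) atTop) (nhds 0) := by
    have h1 : Tendsto (fun t : ℝ => A * ENNReal.ofReal ((t / 2) ^ (-(M - Module.finrank ℝ E))))
        atTop (nhds 0) := by
      have h2 := ENNReal.tendsto_ofReal ((tendsto_rpow_neg_atTop (sub_pos.2 hR1)).comp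
        (tendsto_id.atTop_div_const (zero_lt_two' ℝ)))
      have h3 := ENNReal.Tendsto.const_mul h2 (Or.inr hAtop)
      simpa using h3
    exact h1.comp tendsto_comap
  exact tendsto_of_tendsto_of_tendsto_of_le_of_le' tendsto_const_nhds hzero
    (.of_forall fun _ => zero_le) hbound

end NearField

theorem norm_rpow_mul_div_norm_sub_rpow_le {E : Type*} [NormedAddCommGroup E] {s : ℝ} (hs : 0 ≤ s)
    {x y : E} (hx : 0 < ‖x‖) (hxy : y ∉ ball x (‖x‖ / 2)) (t : ℝ) :
    ‖‖x‖ ^ s * (t / ‖x - y‖ ^ s)‖ ≤ 2 ^ s * ‖t‖ := by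
  have h : ‖x‖ / 2 ≤ ‖x - y‖ := by rwa [mem_ball_iff_norm', not_lt] at hxy
  have h0 : 0 < ‖x - y‖ := by linarith
  have h1 : ‖x‖ ^ s ≤ 2 ^ s * ‖x - y‖ ^ s := by
    rw [← mul_rpow (by norm_num) h0.le]
    exact rpow_le_rpow hx.le (by linarith) hs
  have h2 : 0 < ‖x - y‖ ^ s := by positivity
  rw [norm_mul, norm_div, Real.norm_of_nonneg (by positivity : 0 ≤ ‖x‖ ^ s),
    Real.norm_of_nonneg h2.le, ← mul_div_assoc, div_le_iff₀ h2]
  nlinarith [mul_le_mul_of_nonneg_right h1 (norm_nonneg t)]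

theorem tendsto_norm_div_norm_sub_comap_norm_atTop {E : Type*} [NormedAddCommGroup E] (y : E) :
    Tendsto (fun x : E => ‖x‖ / ‖x - y‖) (comap (fun x : E => ‖x‖) atTop) (nhds 1) := by
  have hn : Tendsto (fun x : E => ‖x‖) (comap (fun x : E => ‖x‖) atTop) atTop := tendsto_comap
  have hc : ∀ c : ℝ, Tendsto (fun x : E => ‖x‖ / (‖x‖ + c)) (comap (fun x : E => ‖x‖) atTop)
      (nhds 1) := by
    intro c
    have h1 : Tendsto (fun x : E => (1 + c / ‖x‖)⁻¹) (comap (fun x : E => ‖x‖) atTop)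
        (nhds (1 + 0)⁻¹) :=
      (tendsto_const_nhds.add (hn.const_div_atTop c)).inv₀ (by norm_num)
    rw [add_zero, inv_one] at h1
    refine h1.congr' ?_
    filter_upwards [hn.eventually_gt_atTop 0] with x hx
    rw [one_add_div hx.ne', inv_div]
  refine tendsto_of_tendsto_of_tendsto_of_le_of_le' (hc ‖y‖) (hc (-‖y‖)) ?_ ?_
  · filter_upwards [hn.eventually_gt_atTop ‖y‖] with x hx
    have := norm_sub_norm_le x y
    have := norm_sub_le x y
    exact div_le_div_of_nonneg_left (norm_nonneg x) (by linarith) (by linarith)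
  · filter_upwards [hn.eventually_gt_atTop ‖y‖] with x hx
    have := norm_sub_norm_le x y
    exact div_le_div_of_nonneg_left (norm_nonneg x) (by linarith) (by linarith)

section RieszPotentialAsymptotics

variable {E : Type*} [NormedAddCommGroup E] [MeasurableSpace E] [BorelSpace E]

theorem tendsto_setIntegral_compl_ball_norm_rpow_mul_div (ρ : Measure E) {s : ℝ} (hs : 0 ≤ s)
    {f : E → ℝ} (hf : Integrable f ρ) :
    Tendsto (fun x : E => ∫ y in (ball x (‖x‖ / 2))ᶜ, ‖x‖ ^ s * (f y / ‖x - y‖ ^ s) ∂ρ)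
      (comap (fun x : E => ‖x‖) atTop) (nhds (∫ y, f y ∂ρ)) := by
  have hn : Tendsto (fun x : E => ‖x‖) (comap (fun x : E => ‖x‖) atTop) atTop := tendsto_comap
  simp_rw [← integral_indicator measurableSet_ball.compl]
  refine tendsto_integral_filter_of_dominated_convergence (fun y => 2 ^ s * ‖f y‖) ?_ ?_
    (hf.norm.const_mul _) ?_
  · refine .of_forall fun x => AEStronglyMeasurable.indicator ?_ measurableSet_ball.compl
    have := hf.aemeasurable
    exact AEMeasurable.aestronglyMeasurable (by fun_prop)
  · filter_upwards [hn.eventually_gt_atTop 0] with x hx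
    refine .of_forall fun y => ?_
    by_cases hy : y ∈ ball x (‖x‖ / 2)
    · rw [Set.indicator_of_notMem (by simpa using hy), norm_zero]
      positivity
    · rw [Set.indicator_of_mem hy]
      exact norm_rpow_mul_div_norm_sub_rpow_le hs hx hy (f y)
  · refine .of_forall fun y => ?_
    have h1 : Tendsto (fun x : E => (‖x‖ / ‖x - y‖) ^ s * f y)
        (comap (fun x : E => ‖x‖) atTop) (nhds (1 ^ s * f y)) :=
      ((tendsto_norm_div_norm_sub_comap_norm_atTop y).rpow_const (Or.inl one_ne_zero)).mul_const _
    rw [one_rpow, one_mul] at h1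
    refine h1.congr' ?_
    filter_upwards [hn.eventually_gt_atTop (2 * ‖y‖)] with x hx
    have hy : y ∈ (ball x (‖x‖ / 2))ᶜ := by
      rw [Set.mem_compl_iff, mem_ball_iff_norm', not_lt]
      linarith [norm_sub_norm_le x y]
    rw [Set.indicator_of_mem hy, div_rpow (norm_nonneg _) (norm_nonneg _)]
    ring

theorem tendsto_norm_rpow_mul_integral_div_norm_sub_rpow (ρ : Measure E) {s : ℝ} (hs : 0 ≤ s)
    {f : E → ℝ} (hf0 : ∀ y, 0 ≤ f y) (hf : Integrable f ρ)
    (hnear : Tendsto (fun x : E => ENNReal.ofReal (‖x‖ ^ s) *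
      ∫⁻ y in ball x (‖x‖ / 2), ENNReal.ofReal (f y / ‖x - y‖ ^ s) ∂ρ)
      (comap (fun x : E => ‖x‖) atTop) (nhds 0)) :
    Tendsto (fun x : E => ‖x‖ ^ s * ∫ y, f y / ‖x - y‖ ^ s ∂ρ)
      (comap (fun x : E => ‖x‖) atTop) (nhds (∫ y, f y ∂ρ)) := by
  have hn : Tendsto (fun x : E => ‖x‖) (comap (fun x : E => ‖x‖) atTop) atTop := tendsto_comap
  have hnear' := (ENNReal.tendsto_toReal ENNReal.zero_ne_top).comp hnear
  have hsum := hnear'.add (tendsto_setIntegral_compl_ball_norm_rpow_mul_div ρ hs hf)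
  rw [ENNReal.toReal_zero, zero_add] at hsum
  refine hsum.congr' ?_
  filter_upwards [hn.eventually_gt_atTop 0, hnear.eventually (gt_mem_nhds zero_lt_one)] with x hx hx1
  have hnn : ∀ y, 0 ≤ f y / ‖x - y‖ ^ s := fun y => div_nonneg (hf0 y) (by positivity)
  have hmeas : AEStronglyMeasurable (fun y => f y / ‖x - y‖ ^ s) ρ := by
    have := hf.aemeasurable
    exact AEMeasurable.aestronglyMeasurable (by fun_prop)
  have hfin : ∫⁻ y in ball x (‖x‖ / 2), ENNReal.ofReal (f y / ‖x - y‖ ^ s) ∂ρ ≠ ⊤ := by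
    intro h
    rw [h, ENNReal.mul_top (by simpa using rpow_pos_of_pos hx s)] at hx1
    exact not_top_lt hx1
  have hint₁ : IntegrableOn (fun y => f y / ‖x - y‖ ^ s) (ball x (‖x‖ / 2)) ρ := by
    refine ⟨hmeas.restrict, ?_⟩
    rw [hasFiniteIntegral_iff_ofReal (.of_forall hnn)]
    exact hfin.lt_top
  have hint₂ : IntegrableOn (fun y => ‖x‖ ^ s * (f y / ‖x - y‖ ^ s)) (ball x (‖x‖ / 2))ᶜ ρ := by
    refine Integrable.mono' (hf.norm.const_mul (2 ^ s)).integrableOn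
      (hmeas.restrict.const_mul _) ?_
    exact (ae_restrict_iff' measurableSet_ball.compl).2
      (.of_forall fun y hy => norm_rpow_mul_div_norm_sub_rpow_le hs hx hy (f y))
  have hint : Integrable (fun y => ‖x‖ ^ s * (f y / ‖x - y‖ ^ s)) ρ := by
    rw [← integrableOn_univ, ← Set.union_compl_self (ball x (‖x‖ / 2))]
    exact IntegrableOn.union (hint₁.const_mul _) hint₂
  rw [← integral_const_mul, ← integral_add_compl measurableSet_ball hint,
    integral_const_mul (μ := ρ.restrict (ball x (‖x‖ / 2))),
    integral_eq_lintegral_of_nonneg_ae (.of_forall hnn) hmeas.restrict, Function.comp_apply,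
    ENNReal.toReal_mul, ENNReal.toReal_ofReal (rpow_nonneg (norm_nonneg x) s)]

end RieszPotentialAsymptotics

theorem finrank_lt_of_integrable_exp_logPotential {E : Type*} [NormedAddCommGroup E]
    [NormedSpace ℝ E] [FiniteDimensional ℝ E] [MeasurableSpace E] [BorelSpace E] [Nontrivial E]
    (ρ : Measure E) [ρ.IsAddHaarMeasure] (ν : Measure E) [IsFiniteMeasure ν]
    (h : Integrable (fun y : E => exp (∫ z, log ((‖z‖ + 1) / ‖y - z‖) ∂ν)) ρ) :
    Module.finrank ℝ E < ν.real Set.univ := by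
  by_contra! hle
  refine not_integrable_one_add_norm_rpow_neg ρ hle (h.mono' ?_ (.of_forall fun y => ?_))
  · exact Measurable.aestronglyMeasurable (by fun_prop)
  · have hy : 0 < 1 + ‖y‖ := by positivity
    rw [Real.norm_of_nonneg (by positivity), rpow_def_of_pos hy, exp_le_exp]
    by_cases hi : Integrable (fun z => log ((‖z‖ + 1) / ‖y - z‖)) ν
    · calc log (1 + ‖y‖) * -ν.real Set.univ = ∫ _, -log (1 + ‖y‖) ∂ν := by
            rw [integral_const, smul_eq_mul]
            ring
        _ ≤ _ := integral_mono (integrable_const _) hi (neg_log_one_add_norm_le_log_div y)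
    · rw [integral_undef hi]
      have : 0 ≤ log (1 + ‖y‖) := log_nonneg (by linarith [norm_nonneg y])
      nlinarith [measureReal_nonneg (μ := ν) (s := Set.univ)]

theorem betaN_pos {n : ℕ} (hn : 0 < n) : 0 < betaN n := by
  have hn' : (0 : ℝ) < n := by exact_mod_cast hn
  have h1 := Gamma_pos_of_pos (by positivity : 0 < (n : ℝ) / 2 + 1)
  have h2 := Gamma_pos_of_pos (by positivity : 0 < (n : ℝ) / 2)
  have h3 : 0 < (volume (ball (0 : EuclideanSpace ℝ (Fin n)) 1)).toReal :=
    ENNReal.toReal_pos (measure_ball_pos _ _ one_pos).ne' measure_ball_lt_top.ne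
  unfold betaN
  positivity

theorem CondB.integrable_V_mul {n : ℕ} {μ : ℝ} {u : EuclideanSpace ℝ (Fin n) → ℝ}
    (hB : CondB n μ u) :
    Integrable (fun y => V n μ u y * exp ((2 * n - μ) / 2 * u y)) := by
  refine hB.2.integral_prod_left.congr (.of_forall fun y => ?_)
  simp only [V, mul_div_assoc, integral_const_mul]
  ring

theorem V_nonneg (n : ℕ) (μ : ℝ) (u : EuclideanSpace ℝ (Fin n) → ℝ)
    (x : EuclideanSpace ℝ (Fin n)) : 0 ≤ V n μ u x :=
  integral_nonneg fun _ => by positivity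

theorem IE.exists_exp_eq_mul_exp_logPotential {n : ℕ} (hn : 0 < n) {μ : ℝ} (hμn : μ < n)
    {u : EuclideanSpace ℝ (Fin n) → ℝ} (hB : CondB n μ u) (hIE : IE n μ u) :
    ∃ (ν : Measure (EuclideanSpace ℝ (Fin n))) (K : ℝ), IsFiniteMeasure ν ∧ 0 < K ∧
      ∀ y, exp ((2 * n - μ) / 2 * u y) = K * exp (∫ z, log ((‖z‖ + 1) / ‖y - z‖) ∂ν) := by
  obtain ⟨C, hC⟩ := hIE
  set c : ℝ := (2 * n - μ) / 2 with hc
  have hn' : (0 : ℝ) < n := by exact_mod_cast hn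
  have hc0 : 0 < c := by rw [hc]; linarith
  have hβ := betaN_pos hn
  set g : EuclideanSpace ℝ (Fin n) → ℝ := fun y => c / betaN n * (V n μ u y * exp (c * u y))
    with hg
  have hg0 : ∀ y, 0 ≤ g y := fun y => by
    have := V_nonneg n μ u y
    positivity
  have hgint : Integrable g := hB.integrable_V_mul.const_mul _
  refine ⟨volume.withDensity fun y => ENNReal.ofReal (g y), exp (c * C),
    isFiniteMeasure_withDensity_ofReal hgint.2, exp_pos _, fun y => ?_⟩
  rw [integral_withDensity_eq_integral_toReal_smul₀ hgint.aemeasurable.ennreal_ofReal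
    (.of_forall fun _ => ENNReal.ofReal_lt_top), ← exp_add, hC y, mul_add, add_comm,
    ← mul_assoc, mul_one_div, ← integral_const_mul]
  congr 2
  refine integral_congr_ae (.of_forall fun z => ?_)
  dsimp only
  rw [ENNReal.toReal_ofReal (hg0 z), smul_eq_mul, hg]
  ring

theorem asymptotics_of_v (n : ℕ) (hn : 2 ≤ n) (μ : ℝ) (hμ0 : 0 < μ) (hμn : μ < n)
    (u : EuclideanSpace ℝ (Fin n) → ℝ) (hu : ContDiff ℝ n u)
    (hB : CondB n μ u) (hIE : IE n μ u) :
    Filter.Tendsto (fun x : EuclideanSpace ℝ (Fin n) => ‖x‖ ^ μ * V n μ u x)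
      (Filter.comap (fun x : EuclideanSpace ℝ (Fin n) => ‖x‖) Filter.atTop)
      (nhds (∫ y : EuclideanSpace ℝ (Fin n), Real.exp ((2 * n - μ) / 2 * u y))) := by
  have : Nontrivial (EuclideanSpace ℝ (Fin n)) :=
    Module.nontrivial_of_finrank_pos (R := ℝ) (by rw [finrank_euclideanSpace_fin]; lia)
  obtain ⟨ν, K, hνfin, hK, hf⟩ := hIE.exists_exp_eq_mul_exp_logPotential (by lia) hμn hB
  have hν : Module.finrank ℝ (EuclideanSpace ℝ (Fin n)) < ν.real Set.univ := by
    refine finrank_lt_of_integrable_exp_logPotential volume ν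
      ((hB.1.const_mul K⁻¹).congr (.of_forall fun y => ?_))
    simp only [hf y]
    field_simp
  refine tendsto_norm_rpow_mul_integral_div_norm_sub_rpow volume hμ0.le
    (fun y => (exp_pos _).le) hB.1 ?_
  have hlim := ENNReal.Tendsto.const_mul (a := ENNReal.ofReal K)
    (tendsto_rpow_mul_lintegral_ball_exp_logPotential volume ν hμ0
      (by rwa [finrank_euclideanSpace_fin]) hν) (Or.inr ENNReal.ofReal_ne_top)
  rw [mul_zero] at hlim
  refine hlim.congr fun x => ?_
  rw [mul_left_comm, ← lintegral_const_mul' _ _ ENNReal.ofReal_ne_top]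
  congr 1
  refine lintegral_congr fun y => ?_
  rw [hf y, ← ENNReal.ofReal_mul (by positivity), ← ENNReal.ofReal_mul hK.le,
    rpow_neg (norm_nonneg _)]
  congr 1
  ring
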